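/- Suppose 1 ≤ s ≤ r. Let k and j_0 be integers with 1 ≤ k ≤ r−1 and 1 ≤ j_0 ≤ m−1 such that m·k − r·j_0 is a nonnegative integer and the 1-tuple (m·k − r·j_0) is an arithmetic pure gap at the single index (0). For 1 ≤ i ≤ s set t_i = m − ⌈(k+i)·m/r⌉ + j_0 if k + i ≠ r, and t_i = m − ⌈(k+i)·m/r⌉ + j_0 − 1 if k + i = r. Then for all integers j_1, …, j_s with 1 ≤ j_i ≤ t_i for each i, and for every permutation σ of {1, …, s}, the tuple (m·k − r·j_0, j_{σ(1)}, …, j_{σ(s)}) is an arithmetic pure gap at the indices (0, 1, …, s). -/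

import Mathlib

open Finset

/-- Floor of the rational number `x / m`. -/
noncomputable def fdivq (m : ℕ) (x : ℤ) : ℤ := ⌊(x : ℚ) / (m : ℚ)⌋

/-- The quantity `∑_{i=0}^{n-1} ⌊(a_i + t·λ_{c i})/m⌋ + ∑_{w ∉ range c} ⌊t·λ_w/m⌋`. -/
noncomputable def gapSum (m r n : ℕ) (lam : Fin (r + 1) → ℤ)
    (c : Fin n → Fin (r + 1)) (a : Fin n → ℤ) (t : ℤ) : ℤ :=
  (∑ i : Fin n, fdivq m (a i + t * lam (c i))) +
    ∑ w ∈ Finset.univ \ Finset.image c Finset.univ, fdivq m (t * lam w)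

/-- `(a 0, …, a (n-1))` is an *arithmetic pure gap* at the (pairwise distinct) indices
`c 0, …, c (n-1)` of `{0,…,r}`: the entries are nonnegative and for every
`t ∈ {0,…,m-1}` exactly one of the two Bartoli–Quoos–Zini conditions holds. -/
noncomputable def IsArithPureGap (m r n : ℕ) (lam : Fin (r + 1) → ℤ)
    (c : Fin n → Fin (r + 1)) (a : Fin n → ℤ) : Prop :=
  (∀ i, 0 ≤ a i) ∧
    ∀ t : ℤ, 0 ≤ t → t ≤ (m : ℤ) - 1 →
      Xor' (gapSum m r n lam c a t < 0)
        (0 ≤ gapSum m r n lam c a t ∧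
          ∀ i : Fin n, fdivq m (a i + t * lam (c i)) = fdivq m (a i + t * lam (c i) - 1))

theorem fdivq_eq_ediv (m : ℕ) (x : ℤ) : fdivq m x = x / (m : ℤ) := by
  simpa [fdivq] using Rat.floor_intCast_div_natCast x m

/-- A nonempty set of `Fin n` contains an index that is at least its cardinality minus one. -/
theorem exists_mem_card_le_val_succ {n : ℕ} {S : Finset (Fin n)} (hS : S.Nonempty) :
    ∃ i ∈ S, #S ≤ (i : ℕ) + 1 := by
  refine ⟨S.max' hS, S.max'_mem hS, ?_⟩
  calc #S ≤ #(Finset.Iic (S.max' hS)) :=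
        Finset.card_le_card fun x hx => Finset.mem_Iic.2 (S.le_max' x hx)
    _ = (S.max' hS : ℕ) + 1 := by simp

theorem ediv_eq_ediv_sub_one_of_not_dvd {m x : ℤ} (hm : 0 < m) (h : ¬ m ∣ x) :
    x / m = (x - 1) / m := by
  have hpos : 0 < x % m :=
    lt_of_le_of_ne (Int.emod_nonneg x hm.ne') fun h' => h (Int.dvd_of_emod_eq_zero h'.symm)
  have hlt := Int.emod_lt_of_pos x hm
  have hx := Int.mul_ediv_add_emod x m
  symm
  rw [Int.ediv_eq_iff_of_pos hm]
  constructor <;> linarith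

/-- The sum in the pure gap criterion at the indices `0, …, s`, for weights `-r·l, l, …, l`. -/
theorem gapSum_castLE_cons {m r s : ℕ} (hsr : s ≤ r) {l : ℤ} {lam : Fin (r + 1) → ℤ}
    (hlam : ∀ i : Fin (r + 1), lam i = if i = 0 then -(r : ℤ) * l else l)
    (a : ℤ) (b : Fin s → ℤ) (t : ℤ) :
    gapSum m r (s + 1) lam (fun i => Fin.castLE (Nat.succ_le_succ hsr) i) (Fin.cons a b) t =
      (a - r * (t * l)) / m + ∑ i, (b i + t * l) / m + ((r : ℤ) - s) * (t * l / m) := by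
  have hinj : Function.Injective
      (fun i : Fin (s + 1) => Fin.castLE (Nat.succ_le_succ hsr) i) :=
    Fin.castLE_injective _
  have hcompl : ∑ w ∈ Finset.univ \ Finset.image
      (fun i : Fin (s + 1) => Fin.castLE (Nat.succ_le_succ hsr) i) Finset.univ,
      fdivq m (t * lam w) = ((r : ℤ) - s) * (t * l / m) := by
    rw [Finset.sum_congr rfl (g := fun _ => t * l / (m : ℤ))]
    · rw [Finset.sum_const, Finset.card_sdiff_of_subset (Finset.subset_univ _),
        Finset.card_image_of_injective _ hinj]
      simp [Nat.cast_sub hsr]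
    · intro w hw
      have hw0 : w ≠ 0 := by
        rintro rfl
        exact (Finset.mem_sdiff.1 hw).2 (Finset.mem_image.2 ⟨0, Finset.mem_univ _, rfl⟩)
      rw [fdivq_eq_ediv, hlam, if_neg hw0]
  rw [gapSum, hcompl, Fin.sum_univ_succ]
  congr 2
  · rw [fdivq_eq_ediv, hlam, if_pos (by simp), Fin.cons_zero]
    congr 1
    ring
  · refine Finset.sum_congr rfl fun i _ => ?_
    rw [fdivq_eq_ediv, hlam, if_neg, Fin.cons_succ]
    simp [Fin.ext_iff]

/-- Writing `t * l = m * q + u`, the sum depends only on the residue `u`. -/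
theorem gapSum_castLE_cons_residue {m r s : ℕ} (hm : 0 < m) (hsr : s ≤ r) {l : ℤ}
    {lam : Fin (r + 1) → ℤ}
    (hlam : ∀ i : Fin (r + 1), lam i = if i = 0 then -(r : ℤ) * l else l)
    (k j : ℤ) (b : Fin s → ℤ) (t : ℤ) :
    gapSum m r (s + 1) lam (fun i => Fin.castLE (Nat.succ_le_succ hsr) i)
        (Fin.cons ((m : ℤ) * k - r * j) b) t =
      k + -(r * (j + t * l % m)) / m + ∑ i, (b i + t * l % m) / m := by
  have hm' : (m : ℤ) ≠ 0 := by positivity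
  rw [gapSum_castLE_cons hsr hlam]
  set q := t * l / (m : ℤ)
  set u := t * l % (m : ℤ)
  have htl : t * l = m * q + u := (Int.mul_ediv_add_emod _ _).symm
  rw [htl, show (m : ℤ) * k - r * j - r * (m * q + u) = -(r * (j + u)) + m * (k - r * q) by ring,
    Int.add_mul_ediv_left _ _ hm',
    Finset.sum_congr rfl fun i _ => show (b i + (m * q + u)) / (m : ℤ) = (b i + u) / m + q by
      rw [show b i + (m * q + u) = b i + u + m * q by ring, Int.add_mul_ediv_left _ _ hm'],
    Finset.sum_add_distrib]
  simp only [Finset.sum_const, Finset.card_univ, Fintype.card_fin, nsmul_eq_mul]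
  ring

/-- A sum of floors whose terms are below `2` is bounded by the number of large terms. -/
theorem sum_ediv_le_card_filter {ι : Type*} [Fintype ι] {m : ℤ} (hm : 0 < m) (x : ι → ℤ)
    (hx : ∀ i, x i < 2 * m) :
    ∑ i, x i / m ≤ #{i | m ≤ x i} := by
  rw [Finset.card_filter, Nat.cast_sum]
  refine Finset.sum_le_sum fun i _ => ?_
  split_ifs with h
  · have : x i / m < 2 := Int.ediv_lt_of_lt_mul hm (hx i)
    push_cast
    omega
  · have : x i / m < 1 := Int.ediv_lt_of_lt_mul hm (by linarith [not_le.1 h])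
    push_cast
    omega

/-- The two inequalities encoded in the bound `t_i` of the family. -/
theorem bounds_of_le_ceil {m r : ℕ} (hm : 0 < m) (hr : 0 < r) (hcop : IsCoprime (m : ℤ) r)
    {k j₀ n : ℤ} (hn : 1 ≤ n) (hj01 : 1 ≤ j₀) (hj02 : j₀ < m) (hnn : r * j₀ ≤ m * k) {x : ℤ}
    (hx : x ≤ if k + n ≠ (r : ℤ)
      then (m : ℤ) - ⌈(((k + n : ℤ) : ℚ) * (m : ℚ)) / (r : ℚ)⌉ + j₀
      else (m : ℤ) - ⌈(((k + n : ℤ) : ℚ) * (m : ℚ)) / (r : ℚ)⌉ + j₀ - 1) :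
    x < m ∧ ∀ u : ℤ, 0 ≤ u → u < m → (m : ℤ) ≤ x + u → (k + n) * m < r * (j₀ + u) := by
  have hm' : (0 : ℤ) < m := by exact_mod_cast hm
  have hr' : (0 : ℤ) < r := by exact_mod_cast hr
  have hle : ∀ y : ℤ, ⌈(((k + n : ℤ) : ℚ) * (m : ℚ)) / (r : ℚ)⌉ ≤ y → (k + n) * m ≤ r * y := by
    intro y hy
    rw [Int.ceil_le, div_le_iff₀ (by exact_mod_cast hr)] at hy
    have : (k + n) * (m : ℤ) ≤ y * r := by exact_mod_cast hy
    linarith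
  have hx' : (k + n) * m ≤ r * (m + j₀ - x) := by
    refine hle _ ?_
    split_ifs at hx <;> linarith
  refine ⟨?_, fun u hu0 hum hxu => ?_⟩
  · by_contra! h
    nlinarith [mul_pos (show (0 : ℤ) < n by linarith) hm', mul_le_mul_of_nonneg_left h hr'.le]
  · refine lt_of_le_of_ne ?_ fun heq => ?_
    · exact hx'.trans (mul_le_mul_of_nonneg_left (by linarith) hr'.le)
    · have hdvd : (m : ℤ) ∣ j₀ + u :=
        hcop.dvd_of_dvd_mul_left (Dvd.intro_left _ heq)
      obtain ⟨c, hc⟩ := hdvd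
      have hc1 : c = 1 := by
        have h0 : 0 < c := by by_contra! h; nlinarith
        have h2 : c < 2 := by by_contra! h; nlinarith
        omega
      subst hc1
      have hkn : k + n = r := by
        rw [hc, mul_one] at heq
        exact mul_right_cancel₀ hm'.ne' heq
      have hxj : (k + n) * m ≤ r * (m + j₀ - 1 - x) := by
        refine hle _ ?_
        rw [if_neg (not_not.2 hkn)] at hx
        linarith
      rw [hkn] at hxj
      have := le_of_mul_le_mul_left hxj hr'
      linarith

/-- A family of pure gaps at `(0,1,…,s)` built from a gap `m·k − r·j₀` at the infinite
place (Proposition precisefamily3). -/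
theorem pureGaps_from_infinite_gap (m r : ℕ) (hm : 2 ≤ m) (hr : 1 ≤ r)
    (l : ℤ) (hl : l ≠ 0) (hgcd : Int.gcd (m : ℤ) ((r : ℤ) * l) = 1)
    (lam : Fin (r + 1) → ℤ)
    (hlam : ∀ i : Fin (r + 1), lam i = if i = 0 then -(r : ℤ) * l else l)
    (s : ℕ) (hs1 : 1 ≤ s) (hsr : s ≤ r)
    (k j₀ : ℤ) (hk1 : 1 ≤ k) (hk2 : k ≤ (r : ℤ) - 1)
    (hj01 : 1 ≤ j₀) (hj02 : j₀ ≤ (m : ℤ) - 1)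
    (hnn : 0 ≤ (m : ℤ) * k - (r : ℤ) * j₀)
    (hgap : IsArithPureGap m r 1 lam (fun _ => (0 : Fin (r + 1)))
      (fun _ => (m : ℤ) * k - (r : ℤ) * j₀))
    (t : Fin s → ℤ)
    (ht : ∀ i : Fin s, t i =
      if k + ((i : ℕ) : ℤ) + 1 ≠ (r : ℤ)
      then (m : ℤ) - ⌈(((k : ℚ) + ((i : ℕ) : ℚ) + 1) * (m : ℚ)) / (r : ℚ)⌉ + j₀
      else (m : ℤ) - ⌈(((k : ℚ) + ((i : ℕ) : ℚ) + 1) * (m : ℚ)) / (r : ℚ)⌉ + j₀ - 1)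
    (jj : Fin s → ℤ) (hjj : ∀ i, 1 ≤ jj i ∧ jj i ≤ t i)
    (σ : Equiv.Perm (Fin s)) :
    IsArithPureGap m r (s + 1) lam
      (fun i => Fin.castLE (Nat.succ_le_succ hsr) i)
      (Fin.cons ((m : ℤ) * k - (r : ℤ) * j₀) (fun i => jj (σ i))) := by
  have hm0 : 0 < m := by omega
  have hm' : (0 : ℤ) < m := by exact_mod_cast hm0
  have hr' : (0 : ℤ) < r := by exact_mod_cast hr
  have hcop : IsCoprime (m : ℤ) r := (Int.isCoprime_iff_gcd_eq_one.2 hgcd).of_mul_right_left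
  have hbounds : ∀ i : Fin s, jj i < m ∧ ∀ u : ℤ, 0 ≤ u → u < m → (m : ℤ) ≤ jj i + u →
      (k + ((i : ℕ) + 1)) * m < r * (j₀ + u) := fun i => by
    refine bounds_of_le_ceil hm0 hr hcop (by omega) hj01 (by omega) (by linarith) ?_
    refine (hjj i).2.trans (ht i).le |>.trans (le_of_eq ?_)
    push_cast
    simp only [add_assoc]
  refine ⟨Fin.cases hnn fun i => zero_le_one.trans (hjj (σ i)).1, fun t _ _ => ?_⟩
  refine (lt_or_ge _ 0).imp (fun hneg => ⟨hneg, fun h => absurd h.1 (not_le.2 hneg)⟩)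
    fun hge => ⟨⟨hge, ?_⟩, not_lt.2 hge⟩
  rw [gapSum_castLE_cons_residue hm0 hsr hlam,
    Equiv.sum_comp σ fun i => (jj i + t * l % m) / (m : ℤ)] at hge
  set u := t * l % (m : ℤ)
  have hu0 : 0 ≤ u := Int.emod_nonneg _ hm'.ne'
  have hum : u < m := Int.emod_lt_of_pos _ hm'
  set S : Finset (Fin s) := {i | (m : ℤ) ≤ jj i + u}
  have hsum : ∑ i, (jj i + u) / (m : ℤ) ≤ #S :=
    sum_ediv_le_card_filter hm' _ fun i => by linarith [(hbounds i).1]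
  have hcard : r * (j₀ + u) ≤ (k + #S) * m := by
    have : -(k + (#S : ℤ)) ≤ -(r * (j₀ + u)) / m := by linarith [hge]
    linarith [(Int.le_ediv_iff_mul_le hm').1 this]
  have hempty : ¬ S.Nonempty := fun hne => by
    obtain ⟨i, hi, hle⟩ := exists_mem_card_le_val_succ hne
    have := (hbounds i).2 u hu0 hum (Finset.mem_filter.1 hi).2
    have hle' : (#S : ℤ) ≤ (i : ℕ) + 1 := by exact_mod_cast hle
    nlinarith
  rw [Finset.not_nonempty_iff_eq_empty] at hempty
  rw [hempty, Finset.card_empty, Nat.cast_zero, add_zero] at hcard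
  have hdvd : (m : ℤ) ∣ t * l - u := Int.dvd_self_sub_emod
  intro i
  rw [fdivq_eq_ediv, fdivq_eq_ediv]
  refine ediv_eq_ediv_sub_one_of_not_dvd hm' ?_
  refine Fin.cases ?_ (fun i => ?_) i
  · intro h
    rw [hlam, if_pos (by simp), Fin.cons_zero] at h
    have h' : (m : ℤ) ∣ r * (j₀ + u) := by
      have := ((dvd_mul_right (m : ℤ) k).sub h).sub (hdvd.mul_left r)
      rwa [show (m : ℤ) * k - (m * k - r * j₀ + t * (-r * l)) - r * (t * l - u) =
        r * (j₀ + u) by ring] at this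
    have := Int.le_of_dvd (by linarith) (hcop.dvd_of_dvd_mul_left h')
    nlinarith
  · intro h
    rw [hlam, if_neg (by simp [Fin.ext_iff]), Fin.cons_succ] at h
    have h' : (m : ℤ) ∣ jj (σ i) + u := by
      have := h.sub hdvd
      rwa [show jj (σ i) + t * l - (t * l - u) = jj (σ i) + u by ring] at this
    have hle := Int.le_of_dvd (by linarith [(hjj (σ i)).1]) h'
    have hmem : σ i ∈ S := Finset.mem_filter.2 ⟨Finset.mem_univ _, hle⟩
    simp [hempty] at hmem
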